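/- arXiv:2104.11442 — 9 statements merged into one kernel-verified Lean document; each statement's English description precedes it below -/
import Mathlib

section
/- There exist functions α, β : ℚ → ℚ, both strictly increasing (i.e., preserving <), such that for every x : ℚ and every rational ε > 0 one has α x < β x and β x < α (x + ε). (Existence of the operations α, β used to define mx.) -/
theorem mx_alpha_beta_exist :
    ∃ α β : ℚ → ℚ, StrictMono α ∧ StrictMono β ∧
      ∀ x ε : ℚ, 0 < ε → α x < β x ∧ β x < α (x + ε) := by
  have : Countable (ℚ ×ₗ Bool) := inferInstanceAs (Countable (ℚ × Bool))
  obtain ⟨f⟩ := Order.embedding_from_countable_to_dense (ℚ ×ₗ Bool) ℚ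
  have lt_of_fst_lt {x y : ℚ} (a b : Bool) (h : x < y) :
      f (toLex (x, a)) < f (toLex (y, b)) :=
    f.strictMono (Prod.Lex.toLex_lt_toLex.2 (Or.inl h))
  exact ⟨fun x => f (toLex (x, false)), fun x => f (toLex (x, true)),
    fun _ _ h => lt_of_fst_lt _ _ h, fun _ _ h => lt_of_fst_lt _ _ h,
    fun x ε hε => ⟨f.strictMono (Prod.Lex.toLex_lt_toLex.2 (Or.inr ⟨rfl, Bool.false_lt_true⟩)),
      lt_of_fst_lt _ _ (lt_add_of_pos_right x hε)⟩⟩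
end

section
/- Let f : ℚ → ℚ → ℚ be a pp-operation. For every n, every i : Fin n, and all finite lists Y, Z of elements of Fin n, the relation { t : Fin n → ℚ | (∃ j ∈ Y, t i ≠ t j) ∨ (∃ j ∈ Z, t i ≥ t j) } defined by a single pp-clause is preserved by f. -/
theorem pp_preserves_single_pp_clause {n : ℕ} (f : ℚ → ℚ → ℚ)
    (hf : ∀ a b a' b' : ℚ,
      f a b ≤ f a' b' ↔ ((a ≤ 0 ∧ a ≤ a') ∨ (0 < a ∧ 0 < a' ∧ b ≤ b')))
    (i : Fin n) (Y Z : List (Fin n)) :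
    ∀ s ∈ { t : Fin n → ℚ | (∃ j ∈ Y, t i ≠ t j) ∨ (∃ j ∈ Z, t i ≥ t j) },
      ∀ t ∈ { t : Fin n → ℚ | (∃ j ∈ Y, t i ≠ t j) ∨ (∃ j ∈ Z, t i ≥ t j) },
        (fun k => f (s k) (t k)) ∈
          { t : Fin n → ℚ | (∃ j ∈ Y, t i ≠ t j) ∨ (∃ j ∈ Z, t i ≥ t j) } := by
  intro s hs t ht
  simp only [Set.mem_ofPred_eq] at hs ht ⊢
  rcases le_or_gt (s i) 0 with hi | hi
  · rcases hs with ⟨j, hj, hne⟩ | ⟨j, hj, hle⟩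
    · refine Or.inl ⟨j, hj, fun heq => hne ?_⟩
      have h₁ := (hf _ _ _ _).mp heq.le
      have h₂ := (hf _ _ _ _).mp heq.ge
      grind
    · exact Or.inr ⟨j, hj, (hf _ _ _ _).mpr (Or.inl ⟨hle.trans hi, hle⟩)⟩
  · rcases ht with ⟨j, hj, hne⟩ | ⟨j, hj, hle⟩
    · refine Or.inl ⟨j, hj, fun heq => hne ?_⟩
      have h₁ := (hf _ _ _ _).mp heq.le
      have h₂ := (hf _ _ _ _).mp heq.ge
      grind
    · refine Or.inr ⟨j, hj, (hf _ _ _ _).mpr ?_⟩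
      grind
end

section
/- For every n, every i : Fin n, and every finite list L of pairs (j, s) with j : Fin n and s : Bool, the relation { t : Fin n → ℚ | ∃ (j, s) ∈ L, (s = true → t i > t j) ∧ (s = false → t i ≥ t j) } defined by a single min-clause is preserved by the operation min : ℚ → ℚ → ℚ. -/
theorem min_preserves_single_min_clause {n : ℕ} (i : Fin n) (L : List (Fin n × Bool)) :
    ∀ s ∈ { t : Fin n → ℚ |
        ∃ p ∈ L, (p.2 = true → t i > t p.1) ∧ (p.2 = false → t i ≥ t p.1) },
      ∀ t ∈ { t : Fin n → ℚ |
          ∃ p ∈ L, (p.2 = true → t i > t p.1) ∧ (p.2 = false → t i ≥ t p.1) },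
        (fun k => min (s k) (t k)) ∈
          { t : Fin n → ℚ |
            ∃ p ∈ L, (p.2 = true → t i > t p.1) ∧ (p.2 = false → t i ≥ t p.1) } := by
  rintro s ⟨p, hp, hp₁, hp₂⟩ t ⟨q, hq, hq₁, hq₂⟩
  rcases le_total (s i) (t i) with h | h
  · refine ⟨p, hp, fun hs => ?_, fun hs => ?_⟩
    · simpa only [min_eq_left h] using (min_le_left _ _).trans_lt (hp₁ hs)
    · simpa only [min_eq_left h] using (min_le_left _ _).trans (hp₂ hs)
  · refine ⟨q, hq, fun hs => ?_, fun hs => ?_⟩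
    · simpa only [min_eq_right h] using (min_le_right _ _).trans_lt (hq₁ hs)
    · simpa only [min_eq_right h] using (min_le_right _ _).trans (hq₂ hs)
end

section
/- Fix strictly increasing α, β : ℚ → ℚ with α x < β x < α (x + ε) for all x and all ε > 0, and let mx be the induced operation. Let R ⊆ (Fin k → ℚ) be invariant under all order automorphisms of ℚ. Then mx preserves R if and only if R is the intersection of finitely many relations, each of which is the satisfaction set of a min-affine formula whose variable set is a subset of Fin k. -/
/-- The operation `mx` induced by unary operations `α`, `β`. -/
def mxOp (α β : ℚ → ℚ) : ℚ → ℚ → ℚ :=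
  fun x y => if x = y then β x else α (min x y)

/-- `T` is near-affine if `T ∪ {(1,…,1)}` is preserved by `(x, y) ↦ x ⊕ y ⊕ 1`. -/
def NearAffine {ι : Type*} (T : Set (ι → Bool)) : Prop :=
  ∀ s ∈ T, ∀ s' ∈ T, (fun i => (s i == s' i)) ∈ T ∪ {fun _ => true}

/-- Satisfaction of the min-affine formula given by a variable set `S ⊆ Fin k`
and a relation `T ⊆ (S → Bool)` by a tuple `b : Fin k → ℚ`. -/
def MinAffineSat {k : ℕ} (S : Set (Fin k)) (T : Set (↥S → Bool)) (b : Fin k → ℚ) : Prop :=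
  ∃ t ∈ T, (∀ i j : ↥S, t i = false → t j = false → b i.1 = b j.1) ∧
           (∀ i j : ↥S, t i = false → t j = true → b i.1 < b j.1)

/-- The indicator on `S` of not attaining the minimum of `b` over `S`. -/
noncomputable def minInd {k : ℕ} (S : Set (Fin k)) (b : Fin k → ℚ) : ↥S → Bool :=
  open Classical in fun i => decide (∃ j : ↥S, b j < b i)

theorem minInd_eq_false {k : ℕ} {S : Set (Fin k)} {b : Fin k → ℚ} {i : ↥S} :
    minInd S b i = false ↔ ∀ j : ↥S, b i ≤ b j := by
  simp [minInd]

theorem minInd_eq_true {k : ℕ} {S : Set (Fin k)} {b : Fin k → ℚ} {i : ↥S} :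
    minInd S b i = true ↔ ∃ j : ↥S, b j < b i := by
  simp [minInd]

theorem minInd_eq_of_const_lt {k : ℕ} {S : Set (Fin k)} {b : Fin k → ℚ} {t : ↥S → Bool}
    (i₀ : ↥S) (h₀ : t i₀ = false)
    (hc : ∀ i j : ↥S, t i = false → t j = false → b i.1 = b j.1)
    (hlt : ∀ i j : ↥S, t i = false → t j = true → b i.1 < b j.1) : minInd S b = t := by
  funext i
  cases hi : t i with
  | false =>
    rw [minInd_eq_false]
    intro j
    cases hj : t j with
    | false => exact (hc i j hi hj).le
    | true => exact (hlt i j hi hj).le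
  | true => exact minInd_eq_true.2 ⟨i₀, hlt i₀ i h₀ hi⟩

theorem minInd_const {k : ℕ} {S : Set (Fin k)} {b : Fin k → ℚ} {i j : ↥S}
    (hi : minInd S b i = false) (hj : minInd S b j = false) : b i = b j :=
  le_antisymm (minInd_eq_false.1 hi j) (minInd_eq_false.1 hj i)

theorem minInd_lt {k : ℕ} {S : Set (Fin k)} {b : Fin k → ℚ} {i j : ↥S}
    (hi : minInd S b i = false) (hj : minInd S b j = true) : b i < b j := by
  obtain ⟨l, hl⟩ := minInd_eq_true.1 hj
  exact (minInd_eq_false.1 hi l).trans_lt hl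

theorem exists_minInd_eq_false {k : ℕ} (S : Set (Fin k)) [Nonempty ↥S] (b : Fin k → ℚ) :
    ∃ i, minInd S b i = false := by
  obtain ⟨i, hi⟩ := Finite.exists_min (fun i : ↥S => b i)
  exact ⟨i, minInd_eq_false.2 hi⟩

theorem minInd_comp {k : ℕ} (S : Set (Fin k)) (b : Fin k → ℚ) (σ : ℚ ≃o ℚ) :
    minInd S (σ ∘ b) = minInd S b := by
  funext i
  simp [minInd]

theorem minAffineSat_iff {k : ℕ} {S : Set (Fin k)} {T : Set (↥S → Bool)} {b : Fin k → ℚ} :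
    MinAffineSat S T b ↔ (fun _ => true) ∈ T ∨ minInd S b ∈ T := by
  constructor
  · rintro ⟨t, ht, hc, hlt⟩
    by_cases h : ∃ i, t i = false
    · obtain ⟨i, hi⟩ := h
      exact Or.inr (minInd_eq_of_const_lt i hi hc hlt ▸ ht)
    · left
      convert ht using 1
      funext i
      exact (Bool.eq_true_of_not_eq_false (not_exists.1 h i)).symm
  · rintro (h | h)
    · exact ⟨_, h, by simp, by simp⟩
    · exact ⟨_, h, fun i j => minInd_const, fun i j => minInd_lt⟩

section mxOp

variable {α β : ℚ → ℚ}

theorem mxOp_comm (x y : ℚ) : mxOp α β x y = mxOp α β y x := by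
  grind [mxOp]

theorem mxOp_self (x : ℚ) : mxOp α β x x = β x := by simp [mxOp]

theorem mxOp_of_lt {x y : ℚ} (h : x < y) : mxOp α β x y = α x := by
  simp [mxOp, h.ne, h.le]

theorem mxOp_of_gt {x y : ℚ} (h : y < x) : mxOp α β x y = α y := by
  rw [mxOp_comm, mxOp_of_lt h]

theorem lt_mxOp (hαβ : ∀ x ε : ℚ, 0 < ε → α x < β x ∧ β x < α (x + ε)) {m x y : ℚ}
    (hx : m < x) (hy : m < y) : β m < mxOp α β x y := by
  have key : ∀ z, m < z → β m < α z := fun z hz => by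
    simpa using (hαβ m (z - m) (sub_pos.2 hz)).2
  unfold mxOp
  split_ifs
  · exact (key x hx).trans (hαβ x 1 one_pos).1
  · exact key _ (lt_min hx hy)

theorem minInd_mxOp_of_lt (hαβ : ∀ x ε : ℚ, 0 < ε → α x < β x ∧ β x < α (x + ε)) {k : ℕ}
    {S : Set (Fin k)} {s t : Fin k → ℚ} {p : ↥S} (hp : minInd S s p = false)
    (h : ∀ i : ↥S, s p < t i) :
    minInd S (fun i => mxOp α β (s i) (t i)) = minInd S s := by
  have h0 : ∀ i : ↥S, minInd S s i = false → mxOp α β (s i) (t i) = α (s p) := fun i hi => by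
    rw [minInd_const hi hp, mxOp_of_lt (h i)]
  refine minInd_eq_of_const_lt p hp (fun i j hi hj => ?_) (fun i j hi hj => ?_)
  · rw [h0 i hi, h0 j hj]
  · rw [h0 i hi]
    exact (hαβ _ 1 one_pos).1.trans (lt_mxOp hαβ (minInd_lt hp hj) (h j))

theorem minInd_mxOp_of_eq (hαβ : ∀ x ε : ℚ, 0 < ε → α x < β x ∧ β x < α (x + ε)) {k : ℕ}
    {S : Set (Fin k)} {s t : Fin k → ℚ} {p q : ↥S} (hp : minInd S s p = false)
    (hq : minInd S t q = false) (h : s p = t q) (hne : minInd S s ≠ minInd S t) :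
    minInd S (fun i => mxOp α β (s i) (t i)) = fun i => (minInd S s i == minInd S t i) := by
  obtain ⟨i₀, hi₀⟩ := Function.ne_iff.1 hne
  have h0 : ∀ i : ↥S, (minInd S s i == minInd S t i) = false →
      mxOp α β (s i) (t i) = α (s p) := fun i hi => by
    cases hs : minInd S s i <;> cases ht : minInd S t i <;> simp [hs, ht] at hi
    · rw [minInd_const hs hp, mxOp_of_lt (h ▸ minInd_lt hq ht)]
    · rw [minInd_const ht hq, ← h, mxOp_of_gt (minInd_lt hp hs)]
  refine minInd_eq_of_const_lt i₀ (by simpa using hi₀) (fun i j hi hj => ?_) (fun i j hi hj => ?_)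
  · rw [h0 i hi, h0 j hj]
  · rw [h0 i hi]
    refine (hαβ _ 1 one_pos).1.trans_le ?_
    cases hs : minInd S s j <;> cases ht : minInd S t j <;> simp [hs, ht] at hj
    · rw [minInd_const hs hp, minInd_const ht hq, ← h, mxOp_self]
    · exact (lt_mxOp hαβ (minInd_lt hp hs) (h ▸ minInd_lt hq ht)).le

theorem minInd_mxOp_self (hαβ : ∀ x ε : ℚ, 0 < ε → α x < β x ∧ β x < α (x + ε)) {k : ℕ}
    {S : Set (Fin k)} {s t : Fin k → ℚ} {p q : ↥S} (hp : minInd S s p = false)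
    (hq : minInd S t q = false) (h : s p = t q) (heq : minInd S s = minInd S t) :
    minInd S (fun i => mxOp α β (s i) (t i)) = minInd S s := by
  have h0 : ∀ i : ↥S, minInd S s i = false → mxOp α β (s i) (t i) = β (s p) := fun i hi => by
    rw [minInd_const hi hp, minInd_const (heq ▸ hi) hq, h, mxOp_self]
  refine minInd_eq_of_const_lt p hp (fun i j hi hj => ?_) (fun i j hi hj => ?_)
  · rw [h0 i hi, h0 j hj]
  · rw [h0 i hi]
    exact lt_mxOp hαβ (minInd_lt hp hj) (h ▸ minInd_lt hq (heq ▸ hj))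

/-- Satisfaction sets of min-affine formulas are preserved by `mx`. -/
theorem minAffineSat_mxOp (hαβ : ∀ x ε : ℚ, 0 < ε → α x < β x ∧ β x < α (x + ε)) {k : ℕ}
    {S : Set (Fin k)} {T : Set (↥S → Bool)} (hT : NearAffine T) {s t : Fin k → ℚ}
    (hs : MinAffineSat S T s) (ht : MinAffineSat S T t) :
    MinAffineSat S T (fun i => mxOp α β (s i) (t i)) := by
  rw [minAffineSat_iff] at hs ht ⊢
  rcases hs with hs | hs
  · exact Or.inl hs
  rcases ht with ht | ht
  · exact Or.inl ht
  right
  rcases isEmpty_or_nonempty ↥S with hS | hS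
  · rwa [Subsingleton.elim (minInd S _) (minInd S s)]
  obtain ⟨p, hp⟩ := exists_minInd_eq_false S s
  obtain ⟨q, hq⟩ := exists_minInd_eq_false S t
  rcases lt_trichotomy (s p) (t q) with h | h | h
  · rwa [minInd_mxOp_of_lt hαβ hp fun i => h.trans_le (minInd_eq_false.1 hq i)]
  · by_cases heq : minInd S s = minInd S t
    · rwa [minInd_mxOp_self hαβ hp hq h heq]
    · rw [minInd_mxOp_of_eq hαβ hp hq h heq]
      refine (hT _ hs _ ht).resolve_right fun h1 => heq ?_
      funext i
      simpa using congrFun h1 i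
  · simp_rw [mxOp_comm (s _)]
    rwa [minInd_mxOp_of_lt hαβ hq fun i => h.trans_le (minInd_eq_false.1 hp i)]

theorem nearAffine_image_minInd (hαβ : ∀ x ε : ℚ, 0 < ε → α x < β x ∧ β x < α (x + ε)) {k : ℕ}
    {R : Set (Fin k → ℚ)} (hR : ∀ σ : ℚ ≃o ℚ, ∀ t ∈ R, (σ ∘ t) ∈ R)
    (hmx : ∀ s ∈ R, ∀ t ∈ R, (fun i => mxOp α β (s i) (t i)) ∈ R) (S : Set (Fin k)) :
    NearAffine (minInd S '' R) := by
  rintro _ ⟨s, hs, rfl⟩ _ ⟨t, ht, rfl⟩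
  rcases isEmpty_or_nonempty ↥S with hS | hS
  · exact Or.inr (Subsingleton.elim _ _)
  obtain ⟨p, hp⟩ := exists_minInd_eq_false S s
  obtain ⟨q, hq⟩ := exists_minInd_eq_false S t
  by_cases heq : minInd S s = minInd S t
  · right
    simp [heq]
  · left
    have h := minInd_comp S t (OrderIso.addRight (s p - t q))
    rw [← h] at hq heq ⊢
    exact ⟨_, hmx s hs _ (hR _ t ht), minInd_mxOp_of_eq hαβ hp hq (by simp) heq⟩

end mxOp

/-- The map fixing everything up to `v` and stretching the rest by the factor `c`. -/
theorem exists_orderIso_stretch (v : ℚ) {c : ℚ} (hc : 0 < c) :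
    ∃ σ : ℚ ≃o ℚ, (∀ x ≤ v, σ x = x) ∧ ∀ x, v < x → σ x = v + c * (x - v) := by
  have key : ∀ c x : ℚ, 0 < c → v < x → v < v + c * (x - v) := fun c x hc hx => by
    have := mul_pos hc (sub_pos.2 hx)
    linarith
  let f : ℚ → ℚ := fun x => if x ≤ v then x else v + c * (x - v)
  have hf : StrictMono f := by
    intro x y hxy
    simp only [f]
    split_ifs with h1 h2 h2
    · exact hxy
    · exact h1.trans_lt (key c y hc (not_le.1 h2))
    · exact absurd (hxy.le.trans h2) h1
    · have := mul_lt_mul_of_pos_left hxy hc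
      linarith
  have hs : Function.Surjective f := by
    intro y
    by_cases h : y ≤ v
    · exact ⟨y, by simp [f, h]⟩
    · have h2 := key c⁻¹ y (inv_pos.2 hc) (not_le.1 h)
      refine ⟨v + c⁻¹ * (y - v), ?_⟩
      simp only [f, not_le.2 h2, if_false]
      field_simp
      ring
  refine ⟨hf.orderIsoOfSurjective f hs, fun x hx => ?_, fun x hx => ?_⟩
  · simp [f, hx]
  · simp [f, not_le.2 hx]

/-- Homogeneity of `(ℚ, <)`. -/
theorem exists_orderIso_comp_eq {ι : Type*} [Finite ι] {r b : ι → ℚ}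
    (h : ∀ i j, b i < b j ↔ r i < r j) : ∃ σ : ℚ ≃o ℚ, σ ∘ r = b := by
  classical
  cases nonempty_fintype ι
  suffices ∀ U : Finset ι, ∃ σ : ℚ ≃o ℚ, ∀ i ∈ U, σ (r i) = b i by
    obtain ⟨σ, hσ⟩ := this Finset.univ
    exact ⟨σ, funext fun i => hσ i (Finset.mem_univ i)⟩
  intro U
  induction U using Finset.induction_on_max_value b with
  | empty => exact ⟨OrderIso.refl ℚ, by simp⟩
  | insert a U _ hmax ih =>
    obtain ⟨σ, hσ⟩ := ih
    by_cases hex : ∃ i ∈ U, b i = b a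
    · obtain ⟨i, hi, hia⟩ := hex
      have hr : r i = r a := le_antisymm
        (not_lt.1 fun hl => hia.not_gt ((h _ _).2 hl)) (not_lt.1 fun hl => hia.not_lt ((h _ _).2 hl))
      refine ⟨σ, fun j hj => ?_⟩
      rcases Finset.mem_insert.1 hj with rfl | hj
      · rw [← hr, hσ i hi, hia]
      · exact hσ j hj
    · have hlt : ∀ i ∈ U, b i < b a := fun i hi =>
        (hmax i hi).lt_of_ne fun he => hex ⟨i, hi, he⟩
      have hlt' : ∀ i ∈ U, b i < σ (r a) := fun i hi => by
        rw [← hσ i hi]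
        exact σ.strictMono ((h _ _).1 (hlt i hi))
      obtain ⟨v, hv, hv'⟩ := Order.exists_between_finsets (U.image b) {b a, σ (r a)}
        (by simpa using fun i hi => ⟨hlt i hi, hlt' i hi⟩)
      simp only [Finset.mem_image, forall_exists_index, and_imp, forall_apply_eq_imp_iff₂,
        Finset.mem_insert, Finset.mem_singleton, forall_eq_or_imp, forall_eq] at hv hv'
      obtain ⟨τ, hτ, hτ'⟩ := exists_orderIso_stretch v
        (div_pos (sub_pos.2 hv'.1) (sub_pos.2 hv'.2))
      refine ⟨σ.trans τ, fun j hj => ?_⟩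
      rw [OrderIso.trans_apply]
      rcases Finset.mem_insert.1 hj with rfl | hj
      · rw [hτ' _ hv'.2, div_mul_cancel₀ _ (sub_pos.2 hv'.2).ne']
        ring
      · rw [hσ j hj, hτ _ (hv j hj).le]

/-- An automorphism of `(ℚ, <)` may push `m` below any bound and finitely many larger
numbers above any bound. -/
theorem exists_orderIso_spread (m lo hi : ℚ) (X : Finset ℚ) (hX : ∀ x ∈ X, m < x) :
    ∃ σ : ℚ ≃o ℚ, σ m = lo ∧ ∀ x ∈ X, hi < σ x := by
  obtain ⟨m', hm, hm'⟩ := Order.exists_between_finsets {m} X (by simpa using hX)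
  simp only [Finset.mem_singleton, forall_eq] at hm
  obtain ⟨σ, hσ⟩ := exists_orderIso_comp_eq (r := ![m, m']) (b := ![lo, max lo hi + 1])
    (by
      have : lo < max lo hi + 1 := (le_max_left lo hi).trans_lt (lt_add_one _)
      simp [Fin.forall_fin_two, hm, this, hm.not_gt, this.not_gt])
  refine ⟨σ, by simpa using congrFun hσ 0, fun x hx => ?_⟩
  have h1 : σ m' = max lo hi + 1 := by simpa using congrFun hσ 1
  calc hi < max lo hi + 1 := (le_max_right lo hi).trans_lt (lt_add_one _)
    _ = σ m' := h1.symm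
    _ < σ x := σ.strictMono (hm' x hx)

/-- If every min-indicator of `b` is realised in `R`, then so is the order type of `b`. -/
theorem exists_mem_lt_iff_lt {k : ℕ} {α β : ℚ → ℚ} (hα : StrictMono α) {R : Set (Fin k → ℚ)}
    (hR : ∀ σ : ℚ ≃o ℚ, ∀ t ∈ R, (σ ∘ t) ∈ R)
    (hmx : ∀ s ∈ R, ∀ t ∈ R, (fun i => mxOp α β (s i) (t i)) ∈ R) {b : Fin k → ℚ}
    (hb : ∀ S : Set (Fin k), ∃ r ∈ R, minInd S r = minInd S b) (U : Finset (Fin k)) :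
    ∃ r ∈ R, ∀ i ∈ U, ∀ j ∈ U, b i < b j ↔ r i < r j := by
  induction U using Finset.strongInduction with
  | H U ih =>
    rcases U.eq_empty_or_nonempty with rfl | hU
    · obtain ⟨r, hr, _⟩ := hb ∅
      exact ⟨r, hr, by simp⟩
    obtain ⟨p, hpU, hp⟩ := U.exists_min_image b hU
    obtain ⟨r, hr, hrb⟩ := hb ↑U
    obtain ⟨s, hs, hsb⟩ := ih (U.filter fun i => b p < b i)
      (Finset.filter_ssubset.2 ⟨p, hpU, lt_irrefl _⟩)
    have hfalse : ∀ i : (↑U : Set (Fin k)), ¬ b p < b i → minInd ↑U b i = false := fun i hi =>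
      minInd_eq_false.2 fun j => (not_lt.1 hi).trans (hp j j.2)
    have hrp := hrb ▸ hfalse ⟨p, hpU⟩ (lt_irrefl _)
    have hreq : ∀ i ∈ U, ¬ b p < b i → r i = r p := fun i hi hi' =>
      minInd_const (S := ↑U) (i := ⟨i, hi⟩) (hrb ▸ hfalse ⟨i, hi⟩ hi') hrp
    have hrlt : ∀ i ∈ U, b p < b i → r p < r i := fun i hi hi' =>
      minInd_lt (S := ↑U) (j := ⟨i, hi⟩) hrp (hrb ▸ minInd_eq_true.2 ⟨⟨p, hpU⟩, hi'⟩)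
    obtain ⟨lo, hlo⟩ := (Set.finite_range s).bddBelow
    obtain ⟨hi, hhi⟩ := (Set.finite_range s).bddAbove
    have hlo' : ∀ i, lo ≤ s i := fun i => hlo ⟨i, rfl⟩
    have hhi' : ∀ i, s i ≤ hi := fun i => hhi ⟨i, rfl⟩
    obtain ⟨σ, hσ, hσ'⟩ := exists_orderIso_spread (r p) (lo - 1) hi
      ((U.filter fun i => b p < b i).image r) (by simpa [forall_comm (α := ℚ)] using hrlt)
    have hv1 : ∀ i ∈ U, ¬ b p < b i → mxOp α β (s i) (σ (r i)) = α (lo - 1) := by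
      intro i hi hi'
      rw [hreq i hi hi', hσ, mxOp_of_gt ((sub_one_lt lo).trans_le (hlo' i))]
    have hv2 : ∀ i ∈ U, b p < b i → mxOp α β (s i) (σ (r i)) = α (s i) := by
      intro i hi hi'
      exact mxOp_of_lt ((hhi' i).trans_lt
        (hσ' _ (Finset.mem_image_of_mem r (Finset.mem_filter.2 ⟨hi, hi'⟩))))
    refine ⟨_, hmx s hs _ (hR σ r hr), fun i hi j hj => ?_⟩
    simp only [Function.comp_apply]
    have hlo1 : ∀ i, lo - 1 < s i := fun i => (sub_one_lt lo).trans_le (hlo' i)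
    by_cases h1 : b p < b i <;> by_cases h2 : b p < b j
    · rw [hv2 i hi h1, hv2 j hj h2, hα.lt_iff_lt]
      exact hsb i (by simp [hi, h1]) j (by simp [hj, h2])
    · rw [hv2 i hi h1, hv1 j hj h2, hα.lt_iff_lt]
      exact iff_of_false ((not_lt.1 h2).trans h1.le).not_gt (hlo1 i).not_gt
    · rw [hv1 i hi h1, hv2 j hj h2, hα.lt_iff_lt]
      exact iff_of_true ((not_lt.1 h1).trans_lt h2) (hlo1 j)
    · rw [hv1 i hi h1, hv1 j hj h2]
      exact iff_of_false ((not_lt.1 h2).trans (hp i hi)).not_gt (lt_irrefl _)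

theorem mx_closed_characterization {k : ℕ} (α β : ℚ → ℚ)
    (hα : StrictMono α) (hβ : StrictMono β)
    (hαβ : ∀ x ε : ℚ, 0 < ε → α x < β x ∧ β x < α (x + ε))
    (R : Set (Fin k → ℚ))
    (hR : ∀ σ : ℚ ≃o ℚ, ∀ t ∈ R, (σ ∘ t) ∈ R) :
    (∀ s ∈ R, ∀ t ∈ R, (fun i => mxOp α β (s i) (t i)) ∈ R) ↔
      ∃ Fs : List ((S : Set (Fin k)) × Set (↥S → Bool)),
        (∀ F ∈ Fs, NearAffine F.2) ∧
        R = { b | ∀ F ∈ Fs, MinAffineSat F.1 F.2 b } := by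
  constructor
  · intro hmx
    refine ⟨(Set.toFinite (Set.range fun S : Set (Fin k) =>
      (⟨S, minInd S '' R⟩ : (S : Set (Fin k)) × Set (↥S → Bool)))).toFinset.toList, ?_, ?_⟩
    · simp only [Finset.mem_toList, Set.Finite.mem_toFinset, Set.forall_mem_range]
      exact nearAffine_image_minInd hαβ hR hmx
    · simp only [Finset.mem_toList, Set.Finite.mem_toFinset, Set.forall_mem_range,
        minAffineSat_iff]
      ext b
      refine ⟨fun hb S => Or.inr ⟨b, hb, rfl⟩, fun hb => ?_⟩
      have hb' : ∀ S : Set (Fin k), ∃ r ∈ R, minInd S r = minInd S b := by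
        intro S
        rcases hb S with ⟨r, hr, h⟩ | h
        · refine ⟨r, hr, ?_⟩
          rcases isEmpty_or_nonempty ↥S with hS | hS
          · exact Subsingleton.elim _ _
          · obtain ⟨i, hi⟩ := exists_minInd_eq_false S r
            simp [h] at hi
        · exact h
      obtain ⟨r, hr, hlt⟩ := exists_mem_lt_iff_lt hα hR hmx hb' Finset.univ
      obtain ⟨σ, rfl⟩ := exists_orderIso_comp_eq (r := r) (b := b) (by simpa using hlt)
      exact hR σ r hr
  · rintro ⟨Fs, hFs, rfl⟩ s hs t ht F hF
    exact minAffineSat_mxOp hαβ (hFs F hF) (hs F hF) (ht F hF)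
end

section
/- Let m, n : ℕ and let S ⊆ ((Fin m → ℚ) × ℚ × (Fin n → ℚ)) be such that (i) for all (z, y, x), (z', y', x') ∈ S, the componentwise minimum ((fun i => min (z i) (z' i)), min y y', (fun i => min (x i) (x' i))) lies in S, and (ii) for every order isomorphism σ : ℚ ≃o ℚ and every (z, y, x) ∈ S, (σ ∘ z, σ y, σ ∘ x) ∈ S. If there exists z₀ : Fin m → ℚ such that for every y : ℚ there exists x with (z₀, y, x) ∈ S, then for every z : Fin m → ℚ: (∀ y, ∃ x, (z, y, x) ∈ S) if and only if (∃ y, ∃ x, (z, y, x) ∈ S ∧ ∀ i, z i < y). (Lemma on eliminating a universal quantifier, min case.) -/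
/-- Any point above `c` can be moved to any other point above `c` by an automorphism of `ℚ`
that fixes every point of the ray below `c`. -/
theorem exists_orderIso_rat_fix_Iic {c y y' : ℚ} (hy : c < y) (hy' : c < y') :
    ∃ σ : ℚ ≃o ℚ, (∀ t ≤ c, σ t = t) ∧ σ y = y' := by
  have hk : 0 < (y' - c) / (y - c) := div_pos (sub_pos.2 hy') (sub_pos.2 hy)
  have hyc : y - c ≠ 0 := (sub_pos.2 hy).ne'
  have hky : (y' - c) / (y - c) * (y - c) = y' - c := div_mul_cancel₀ _ hyc
  generalize (y' - c) / (y - c) = k at hk hky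
  let f : ℚ → ℚ := fun t => if t ≤ c then t else c + k * (t - c)
  have hf : StrictMono f := by
    intro a b hab
    simp only [f]
    split_ifs with ha hb hb
    · exact hab
    · have := mul_pos hk (sub_pos.2 (not_le.1 hb))
      linarith
    · exact absurd (hab.le.trans hb) ha
    · have := mul_lt_mul_of_pos_left (sub_lt_sub_right hab c) hk
      linarith
  have hs : Function.Surjective f := by
    intro b
    by_cases hb : b ≤ c
    · exact ⟨b, if_pos hb⟩
    · have hpos : 0 < (b - c) / k := div_pos (sub_pos.2 (not_le.1 hb)) hk
      refine ⟨c + (b - c) / k, ?_⟩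
      simp only [f]
      rw [if_neg (by linarith), add_sub_cancel_left, mul_div_cancel₀ _ hk.ne']
      ring
  refine ⟨hf.orderIsoOfSurjective f hs, fun t ht => if_pos ht, ?_⟩
  change f y = y'
  simp only [f]
  rw [if_neg (not_le.2 hy), hky]
  ring

theorem eliminate_universal_min {m n : ℕ}
    (S : Set ((Fin m → ℚ) × ℚ × (Fin n → ℚ)))
    (hmin : ∀ p ∈ S, ∀ q ∈ S,
      ((fun i => min (p.1 i) (q.1 i)), min p.2.1 q.2.1,
        (fun i => min (p.2.2 i) (q.2.2 i))) ∈ S)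
    (hauto : ∀ σ : ℚ ≃o ℚ, ∀ p ∈ S, (σ ∘ p.1, σ p.2.1, σ ∘ p.2.2) ∈ S)
    (hsat : ∃ z₀ : Fin m → ℚ, ∀ y : ℚ, ∃ x : Fin n → ℚ, (z₀, y, x) ∈ S) :
    ∀ z : Fin m → ℚ,
      (∀ y : ℚ, ∃ x : Fin n → ℚ, (z, y, x) ∈ S) ↔
      (∃ y : ℚ, ∃ x : Fin n → ℚ, (z, y, x) ∈ S ∧ ∀ i, z i < y) := by
  intro z
  constructor
  · intro h
    obtain ⟨b, hb⟩ := Finite.bddAbove_range z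
    obtain ⟨x, hx⟩ := h (b + 1)
    exact ⟨b + 1, x, hx, fun i => (hb ⟨i, rfl⟩).trans_lt (lt_add_one b)⟩
  · rintro ⟨y, x, hx, hzy⟩ y'
    obtain ⟨w, u, hu, hw⟩ : ∃ w, ∃ u : Fin n → ℚ, (z, w, u) ∈ S ∧ y' ≤ w := by
      obtain hle | hge := le_total y' y
      · exact ⟨y, x, hx, hle⟩
      obtain ⟨c, hc, hcy⟩ : ∃ c, (∀ i, z i < c) ∧ c < y :=
        ((Filter.eventually_all.2 fun i =>
          (Filter.eventually_of_mem (Ioo_mem_nhdsLT (hzy i)) fun _ h => h.1)).and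
            self_mem_nhdsWithin).exists
      obtain ⟨σ, hσ, hσy⟩ := exists_orderIso_rat_fix_Iic hcy (hcy.trans_le hge)
      have hσz : σ ∘ z = z := funext fun i => hσ _ (hc i).le
      have := hauto σ _ hx
      simp only [hσz, hσy] at this
      exact ⟨y', σ ∘ x, this, le_rfl⟩
    obtain ⟨z₀, h₀⟩ := hsat
    obtain ⟨d, hd⟩ := Finite.bddAbove_range fun i => z i - z₀ i
    obtain ⟨v, hv⟩ := h₀ (y' - d)
    have hS := hmin _ hu _ (hauto (OrderIso.addRight d) _ hv)
    have hz : (fun i => min (z i) (z₀ i + d)) = z := funext fun i =>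
      min_eq_left (by have := hd ⟨i, rfl⟩; simp only at this; linarith)
    simp only [Function.comp_apply, OrderIso.addRight_apply, sub_add_cancel, hz,
      min_eq_right hw] at hS
    exact ⟨_, hS⟩
end

section
/- Let n : ℕ and let t, t' : Fin n → ℚ be tuples such that for all i, j : Fin n, t i ≤ t j if and only if t' i ≤ t' j. Then there exists an order isomorphism σ : ℚ ≃o ℚ with σ (t i) = t' i for all i. (Homogeneity of (ℚ,<): any two n-tuples with the same order pattern lie in the same orbit of Aut(ℚ,<).) -/
/-- Back and forth: every finite partial isomorphism between countable dense linear orders without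
endpoints extends to an order isomorphism. -/
theorem Order.PartialIso.exists_orderIso_extending {α β : Type*} [LinearOrder α] [LinearOrder β]
    [Countable α] [DenselyOrdered α] [NoMinOrder α] [NoMaxOrder α] [Nonempty α]
    [Countable β] [DenselyOrdered β] [NoMinOrder β] [NoMaxOrder β] [Nonempty β]
    (f : Order.PartialIso α β) :
    ∃ σ : α ≃o β, ∀ p ∈ f.val, σ p.1 = p.2 := by
  cases nonempty_encodable α
  cases nonempty_encodable β
  let D : α ⊕ β → Order.Cofinal (Order.PartialIso α β) := fun p ↦
    Sum.recOn p (definedAtLeft β) (definedAtRight α)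
  let I : Order.Ideal (Order.PartialIso α β) := Order.idealOfCofinals f D
  let F a := funOfIdeal a I (Order.cofinal_meets_idealOfCofinals _ D (Sum.inl a))
  let G b := invOfIdeal b I (Order.cofinal_meets_idealOfCofinals _ D (Sum.inr b))
  refine ⟨OrderIso.ofCmpEqCmp (fun a ↦ (F a).val) (fun b ↦ (G b).val) fun a b ↦ ?_,
    fun p hp ↦ ?_⟩
  · obtain ⟨g, hg, ha⟩ := (F a).prop
    obtain ⟨k, hk, hb⟩ := (G b).prop
    obtain ⟨m, _, gm, km⟩ := I.directed _ hg _ hk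
    exact m.prop (a, _) (gm ha) (_, b) (km hb)
  · obtain ⟨g, hg, ha⟩ := (F p.1).prop
    obtain ⟨m, _, fm, gm⟩ := I.directed _ (Order.mem_idealOfCofinals f D) _ hg
    have hcmp := m.prop (p.1, _) (gm ha) p (fm hp)
    rw [cmp_self_eq_eq] at hcmp
    exact (cmp_eq_eq_iff _ _).mp hcmp.symm

theorem rat_order_homogeneous {n : ℕ} (t t' : Fin n → ℚ)
    (h : ∀ i j : Fin n, t i ≤ t j ↔ t' i ≤ t' j) :
    ∃ σ : ℚ ≃o ℚ, ∀ i, σ (t i) = t' i := by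
  let f : Order.PartialIso ℚ ℚ := ⟨Finset.univ.image fun i ↦ (t i, t' i), by
    simp only [Finset.mem_image, Finset.mem_univ, true_and]
    rintro _ ⟨i, rfl⟩ _ ⟨j, rfl⟩
    have hlt : ∀ i j, t i < t j ↔ t' i < t' j := fun i j ↦ by
      simpa only [not_le] using not_congr (h j i)
    simp only [cmp, cmpUsing, hlt]⟩
  obtain ⟨σ, hσ⟩ := f.exists_orderIso_extending
  exact ⟨σ, fun i ↦ hσ _ (Finset.mem_image_of_mem _ (Finset.mem_univ i))⟩
end

section
/- Fix strictly increasing α, β : ℚ → ℚ with α x < β x < α (x + ε) for all x and all ε > 0, and let mx be the induced operation. Let k ≥ 1 and let R ⊆ (Fin k → ℚ) be preserved by mx and invariant under all order automorphisms of ℚ. Then the set T = { min-tuple of b | b ∈ R } ⊆ (Fin k → Bool) is near-affine. -/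
/-- The min-tuple of `b`: `false` exactly at the coordinates where `b` attains
its minimum value. -/
def minTuple {k : ℕ} (b : Fin k → ℚ) : Fin k → Bool :=
  fun i => decide (∃ j, b j < b i)

/-- If `m` is a lower bound of `b` that is attained, the min-tuple is read off by comparison
with `m`. -/
theorem minTuple_eq_decide_lt {k : ℕ} {b : Fin k → ℚ} {m : ℚ} (hle : ∀ i, m ≤ b i)
    (hm : ∃ j, b j = m) : minTuple b = fun i => decide (m < b i) := by
  obtain ⟨j, rfl⟩ := hm
  funext i
  exact decide_eq_decide.2 ⟨fun ⟨l, hl⟩ => (hle l).trans_lt hl, fun h => ⟨j, h⟩⟩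

/-- In a relation invariant under order automorphisms, every min-tuple is realised by a
tuple with minimum `0`. -/
theorem exists_mem_min_eq_zero {k : ℕ} (hk : 1 ≤ k) {R : Set (Fin k → ℚ)}
    (hR : ∀ σ : ℚ ≃o ℚ, ∀ t ∈ R, (σ ∘ t) ∈ R) {b : Fin k → ℚ} (hb : b ∈ R) :
    ∃ c ∈ R, (∀ i, 0 ≤ c i) ∧ minTuple b = fun i => decide (0 < c i) := by
  have : Nonempty (Fin k) := ⟨⟨0, hk⟩⟩
  obtain ⟨j, hj⟩ := Finite.exists_min b
  refine ⟨_, hR (OrderIso.addRight (-b j)) b hb, fun i => ?_, ?_⟩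
  · simpa using hj i
  · rw [minTuple_eq_decide_lt hj ⟨j, rfl⟩]
    simp

/-- On nonnegative arguments `mxOp` is at least `α 0`, with equality exactly when one of the
arguments is zero and the other is not. -/
theorem mxOp_nonneg_cases {α β : ℚ → ℚ} (hα : StrictMono α) (hαβ : ∀ x, α x < β x)
    {x y : ℚ} (hx : 0 ≤ x) (hy : 0 ≤ y) :
    α 0 ≤ mxOp α β x y ∧ (α 0 < mxOp α β x y ↔ (0 < x ↔ 0 < y)) := by
  unfold mxOp
  split_ifs with h
  · subst h
    have hlt : α 0 < β x := (hα.monotone hx).trans_lt (hαβ x)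
    exact ⟨hlt.le, by simp [hlt]⟩
  · refine ⟨hα.monotone (le_min hx hy), ?_⟩
    rw [hα.lt_iff_lt, lt_min_iff]
    grind

theorem minTuples_of_mx_closed_near_affine {k : ℕ} (α β : ℚ → ℚ)
    (hα : StrictMono α) (hβ : StrictMono β)
    (hαβ : ∀ x ε : ℚ, 0 < ε → α x < β x ∧ β x < α (x + ε))
    (hk : 1 ≤ k) (R : Set (Fin k → ℚ))
    (hpres : ∀ s ∈ R, ∀ t ∈ R, (fun i => mxOp α β (s i) (t i)) ∈ R)
    (hR : ∀ σ : ℚ ≃o ℚ, ∀ t ∈ R, (σ ∘ t) ∈ R) :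
    NearAffine { t : Fin k → Bool | ∃ b ∈ R, minTuple b = t } := by
  rintro _ ⟨b, hb, rfl⟩ _ ⟨b', hb', rfl⟩
  obtain ⟨c, hc, hc0, hbc⟩ := exists_mem_min_eq_zero hk hR hb
  obtain ⟨c', hc', hc0', hbc'⟩ := exists_mem_min_eq_zero hk hR hb'
  have hmx i := mxOp_nonneg_cases hα (fun x => (hαβ x 1 one_pos).1) (hc0 i) (hc0' i)
  have heq : (fun i => minTuple b i == minTuple b' i) =
      fun i => decide (α 0 < mxOp α β (c i) (c' i)) := by
    funext i
    rw [hbc, hbc', Bool.eq_iff_iff]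
    simp [(hmx i).2]
  rw [heq]
  by_cases hall : ∀ i, α 0 < mxOp α β (c i) (c' i)
  · right
    simp [hall]
  · left
    push Not at hall
    obtain ⟨j, hj⟩ := hall
    exact ⟨_, hpres c hc c' hc',
      minTuple_eq_decide_lt (fun i => (hmx i).1) ⟨j, hj.antisymm (hmx j).1⟩⟩
end

section
/- Let f : ℚ → ℚ → ℚ be a pp-operation. Then f preserves the ternary relation P = { (x, y, z) : ℚ³ | (x = y ∧ y < z) ∨ (x > y ∧ y = z) }, i.e., for all (x, y, z), (x', y', z') ∈ P, the triple (f x x', f y y', f z z') lies in P. -/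
theorem pp_preserves_P (f : ℚ → ℚ → ℚ)
    (hf : ∀ a b a' b' : ℚ,
      f a b ≤ f a' b' ↔ ((a ≤ 0 ∧ a ≤ a') ∨ (0 < a ∧ 0 < a' ∧ b ≤ b'))) :
    ∀ x y z x' y' z' : ℚ,
      ((x = y ∧ y < z) ∨ (x > y ∧ y = z)) →
      ((x' = y' ∧ y' < z') ∨ (x' > y' ∧ y' = z')) →
      ((f x x' = f y y' ∧ f y y' < f z z') ∨ (f x x' > f y y' ∧ f y y' = f z z')) := by
  intro x y z x' y' z' h h'
  simp only [gt_iff_lt, le_antisymm_iff (a := f _ _), ← not_le (a := f _ _), hf]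
  grind
end

section
/- Fix strictly increasing α, β : ℚ → ℚ with α x < β x < α (x + ε) for all x and all ε > 0, and let mx be the induced operation. Then mx does not preserve the ternary relation P = { (x, y, z) : ℚ³ | (x = y ∧ y < z) ∨ (x > y ∧ y = z) }: there exist (x, y, z), (x', y', z') ∈ P such that (mx x x', mx y y', mx z z') ∉ P. -/
theorem mx_does_not_preserve_P (α β : ℚ → ℚ)
    (hα : StrictMono α) (hβ : StrictMono β)
    (hαβ : ∀ x ε : ℚ, 0 < ε → α x < β x ∧ β x < α (x + ε)) :
    ∃ x y z x' y' z' : ℚ,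
      ((x = y ∧ y < z) ∨ (x > y ∧ y = z)) ∧
      ((x' = y' ∧ y' < z') ∨ (x' > y' ∧ y' = z')) ∧
      ¬((mxOp α β x x' = mxOp α β y y' ∧ mxOp α β y y' < mxOp α β z z') ∨
        (mxOp α β x x' > mxOp α β y y' ∧ mxOp α β y y' = mxOp α β z z')) := by
  have h := (hαβ 0 1 one_pos).1
  refine ⟨0, 0, 1, 1, 0, 0, by norm_num, by norm_num, ?_⟩
  have h₁ : mxOp α β 0 1 = α 0 := by simp [mxOp]
  have h₂ : mxOp α β 0 0 = β 0 := by simp [mxOp]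
  rw [h₁, h₂]
  rintro (⟨heq, -⟩ | ⟨hgt, -⟩)
  · exact h.ne heq
  · exact lt_asymm h hgt
end
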